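/- arXiv:1412.6687 — 8 statements merged into one kernel-verified Lean document; each statement's English description precedes it below -/
import Mathlib

section
/- Assume 2·T_AJ > e²·Δ and 36·η·Δ²·log 2 > 1 (with η := c_T·P·log 2), so that 9·η·x²·log(x/Δ) > 1 for all x ≥ 2Δ. Then from every starting point (x⁰, y⁰) ∈ [2Δ, ∞) × [0, ∞) the best response dynamics x^(i) := b_T(y^(i−1)), y^(i) := b_J(x^(i−1)) converges: the sequence (x^(i), y^(i)) tends, as i → ∞, to the unique Nash equilibrium of the jamming game. -/
/-- Capacity of the timing channel: `C(x,y) = log₂(x/Δ)/(T_AJ + y + x/2)`. -/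
noncomputable def Cap (Δ T_AJ x y : ℝ) : ℝ := Real.logb 2 (x / Δ) / (T_AJ + y + x / 2)

/-- The target node's utility `U_T(x,y) = C(x,y)`. -/
noncomputable def UT (Δ T_AJ x y : ℝ) : ℝ := Cap Δ T_AJ x y

/-- The jammer's utility `U_J(x,y) = −C(x,y) − c_T·P·y`. -/
noncomputable def UJ (Δ T_AJ P c_T x y : ℝ) : ℝ := -(Cap Δ T_AJ x y) - c_T * P * y

/-- `χ(x) = √(log(x/Δ)/η) − T_AJ − x/2`. -/
noncomputable def chi (Δ T_AJ η x : ℝ) : ℝ :=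
  Real.sqrt (Real.log (x / Δ) / η) - T_AJ - x / 2

/-- The jammer's best response `b_J(x) = max(χ(x), 0)`. -/
noncomputable def bJ (Δ T_AJ η x : ℝ) : ℝ := max (chi Δ T_AJ η x) 0

/-- `(x*,y*) ∈ [2Δ,∞) × [0,∞)` is a Nash equilibrium of the jamming game. -/
def IsNE (Δ T_AJ P c_T xs ys : ℝ) : Prop :=
  2 * Δ ≤ xs ∧ 0 ≤ ys ∧
  (∀ x : ℝ, 2 * Δ ≤ x → UT Δ T_AJ x ys ≤ UT Δ T_AJ xs ys) ∧
  (∀ y : ℝ, 0 ≤ y → UJ Δ T_AJ P c_T xs y ≤ UJ Δ T_AJ P c_T xs ys)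

/-- The jammer's cost `s²/u + u` over `u ≥ A` is minimised only at `u = max s A`. -/
lemma sq_div_add_lt_of_ne_max {s A u : ℝ} (hs : 0 ≤ s) (hA : 0 < A) (hu : A ≤ u)
    (hne : u ≠ max s A) :
    s ^ 2 / max s A + max s A < s ^ 2 / u + u := by
  have hu0 : 0 < u := hA.trans_le hu
  have hm : 0 < max s A := lt_max_of_lt_right hA
  have key : s ^ 2 / u + u - (s ^ 2 / max s A + max s A)
      = (u - max s A) * (u * max s A - s ^ 2) / (u * max s A) := by
    field_simp
    ring
  have hpos : 0 < (u - max s A) * (u * max s A - s ^ 2) := by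
    rcases le_total A s with h | h
    · rw [max_eq_left h] at hne hm ⊢
      have : 0 < (u - s) ^ 2 := by positivity [sub_ne_zero.mpr hne]
      nlinarith
    · rw [max_eq_right h] at hne ⊢
      have hlt : A < u := lt_of_le_of_ne hu (Ne.symm hne)
      exact mul_pos (by linarith) (by nlinarith)
  have := div_pos hpos (mul_pos hu0 hm)
  linarith

/-- `bJ` is the jammer's unique best response. -/
lemma UJ_lt_UJ_bJ {Δ T P c η x y : ℝ} (hΔ : 0 < Δ) (hT : 0 < T) (hη0 : 0 < η)
    (hη : η = c * P * Real.log 2) (hx : 2 * Δ ≤ x) (hy : 0 ≤ y) (hne : y ≠ bJ Δ T η x) :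
    UJ Δ T P c x y < UJ Δ T P c x (bJ Δ T η x) := by
  have hl2 : 0 < Real.log 2 := Real.log_pos one_lt_two
  have hL : 0 ≤ Real.log (x / Δ) := Real.log_nonneg (by rw [le_div_iff₀ hΔ]; linarith)
  have hA : 0 < T + x / 2 := by linarith
  set s := Real.sqrt (Real.log (x / Δ) / η) with hs
  have hs2 : Real.log (x / Δ) = η * s ^ 2 := by
    rw [hs, Real.sq_sqrt (by positivity)]
    field_simp
  have hb : bJ Δ T η x = max s (T + x / 2) - (T + x / 2) := by
    rw [bJ, chi, ← hs, ← max_sub_sub_right]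
    congr 1 <;> ring
  have hU (z : ℝ) : UJ Δ T P c x z =
      η / Real.log 2 * (T + x / 2 - (s ^ 2 / (T + x / 2 + z) + (T + x / 2 + z))) := by
    have hcP : c * P = η / Real.log 2 := by rw [hη]; field_simp
    rw [UJ, Cap, Real.logb, hs2, hcP, add_right_comm T z]
    ring
  have key := sq_div_add_lt_of_ne_max (u := T + x / 2 + y) (Real.sqrt_nonneg _ : 0 ≤ s) hA
    (by linarith) (by intro h; exact hne (by rw [hb]; linarith))
  rw [hU, hU, hb, add_sub_cancel]
  exact mul_lt_mul_of_pos_left (by linarith) (by positivity)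

/-- The solution of the first-order condition is the target node's unique best response. -/
lemma UT_lt_UT_of_stationary {Δ T x b y : ℝ} (hΔ : 0 < Δ) (hT : 0 < T) (hy : 0 ≤ y)
    (hb : Real.exp 1 * Δ < b) (hbe : b * Real.log (b / (Real.exp 1 * Δ)) = 2 * (T + y))
    (hx : 0 < x) (hne : x ≠ b) :
    UT Δ T x y < UT Δ T b y := by
  have hl2 : 0 < Real.log 2 := Real.log_pos one_lt_two
  have hb0 : 0 < b := lt_trans (by positivity) hb
  have hlog : Real.log (b / (Real.exp 1 * Δ)) = Real.log (b / Δ) - 1 := by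
    rw [Real.log_div hb0.ne' (by positivity), Real.log_div hb0.ne' hΔ.ne',
      Real.log_mul (by positivity) hΔ.ne', Real.log_exp]
    ring
  rw [hlog] at hbe
  have hrat : Real.log (x / b) < x / b - 1 :=
    Real.log_lt_sub_one_of_pos (by positivity) (by rwa [Ne, div_eq_one_iff_eq hb0.ne'])
  rw [Real.log_div hx.ne' hb0.ne'] at hrat
  have hval : Real.log (b / Δ) / (T + y + b / 2) = 2 / b := by
    rw [div_eq_div_iff (by positivity) hb0.ne']
    linarith
  have hlt : Real.log (x / Δ) / (T + y + x / 2) < 2 / b := by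
    have h : Real.log (x / Δ) < Real.log (b / Δ) - 1 + x / b := by
      rw [Real.log_div hx.ne' hΔ.ne', Real.log_div hb0.ne' hΔ.ne']
      linarith
    have h' : Real.log (b / Δ) - 1 = 2 * (T + y) / b := by
      rw [eq_div_iff hb0.ne']
      linarith
    rw [div_lt_iff₀ (by positivity)]
    calc Real.log (x / Δ) < 2 * (T + y) / b + x / b := by linarith
      _ = 2 / b * (T + y + x / 2) := by ring
  rw [UT, UT, Cap, Cap, Real.logb, Real.logb, div_right_comm, div_right_comm _ (Real.log 2), hval]
  exact div_lt_div_of_pos_right hlt hl2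

/-- `x ↦ x log (x / c)` grows at rate at least `1 + log (a / c)` beyond `a`. -/
lemma mul_sub_le_mul_log_sub {c a b : ℝ} (hc : 0 < c) (ha : 0 < a) (hab : a ≤ b) :
    (1 + Real.log (a / c)) * (b - a) ≤ b * Real.log (b / c) - a * Real.log (a / c) := by
  have hb : 0 < b := ha.trans_le hab
  have h : Real.log (a / b) ≤ a / b - 1 := Real.log_le_sub_one_of_pos (by positivity)
  have h' : b * Real.log (a / b) ≤ a - b := by
    calc b * Real.log (a / b) ≤ b * (a / b - 1) := mul_le_mul_of_nonneg_left h hb.le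
      _ = a - b := by field_simp
  rw [Real.log_div ha.ne' hb.ne'] at h'
  rw [Real.log_div ha.ne' hc.ne', Real.log_div hb.ne' hc.ne']
  linarith

/-- The target node's best response is a contraction on `[0, ∞)`. -/
lemma exists_abs_bT_sub_le {Δ T : ℝ} {bT : ℝ → ℝ} (hΔ : 0 < Δ)
    (h1 : Real.exp 1 ^ 2 * Δ < 2 * T)
    (hbT : ∀ y : ℝ, 0 ≤ y → Real.exp 1 * Δ < bT y ∧
      bT y * Real.log (bT y / (Real.exp 1 * Δ)) = 2 * (T + y)) :
    ∃ k : ℝ, 0 < k ∧ k < 1 ∧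
      ∀ y z : ℝ, 0 ≤ y → 0 ≤ z → |bT y - bT z| ≤ k * |y - z| := by
  have hc : 0 < Real.exp 1 * Δ := by positivity
  have hpos (y : ℝ) (hy : 0 ≤ y) : 0 < bT y := hc.trans (hbT y hy).1
  have hlog_pos (y : ℝ) (hy : 0 ≤ y) : 0 < Real.log (bT y / (Real.exp 1 * Δ)) :=
    Real.log_pos (by rw [one_lt_div hc]; exact (hbT y hy).1)
  have hmono {y z : ℝ} (hy : 0 ≤ y) (hyz : y ≤ z) : bT y ≤ bT z := by
    by_contra! h
    have hz := hy.trans hyz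
    have := mul_sub_le_mul_log_sub hc (hpos z hz) h.le
    rw [(hbT y hy).2, (hbT z hz).2] at this
    nlinarith [hlog_pos z hz]
  set l := Real.log (bT 0 / (Real.exp 1 * Δ)) with hl
  have hl1 : 1 < l := by
    by_contra! h
    have hle : bT 0 ≤ Real.exp 1 * (Real.exp 1 * Δ) := by
      rw [← div_le_iff₀ hc]
      exact (Real.log_le_iff_le_exp (div_pos (hpos 0 le_rfl) hc)).1 h
    have := (hbT 0 le_rfl).2
    nlinarith [hpos 0 le_rfl]
  have hle {y z : ℝ} (hy : 0 ≤ y) (hyz : y ≤ z) : bT z - bT y ≤ 2 / (1 + l) * (z - y) := by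
    have h := mul_sub_le_mul_log_sub hc (hpos y hy) (hmono hy hyz)
    rw [(hbT y hy).2, (hbT z (hy.trans hyz)).2] at h
    have hly : l ≤ Real.log (bT y / (Real.exp 1 * Δ)) :=
      Real.log_le_log (div_pos (hpos 0 le_rfl) hc)
        (div_le_div_of_nonneg_right (hmono le_rfl hy) hc.le)
    rw [div_mul_eq_mul_div, le_div_iff₀ (by linarith)]
    nlinarith [hmono hy hyz]
  refine ⟨2 / (1 + l), by positivity, by rw [div_lt_one] <;> linarith, fun y z hy hz => ?_⟩
  rcases le_total y z with h | h
  · rw [abs_sub_comm, abs_sub_comm y, abs_of_nonneg (sub_nonneg.2 (hmono hy h)),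
      abs_of_nonneg (sub_nonneg.2 h)]
    exact hle hy h
  · rw [abs_of_nonneg (sub_nonneg.2 (hmono hz h)), abs_of_nonneg (sub_nonneg.2 h)]
    exact hle hz h

/-- The jammer's best response is nonexpansive on `[2Δ, ∞)`. -/
lemma abs_bJ_sub_le {Δ T η : ℝ} (hΔ : 0 < Δ) (hη : 0 < η)
    (hχ : ∀ x : ℝ, 2 * Δ ≤ x → 1 < 9 * η * x ^ 2 * Real.log (x / Δ))
    {x z : ℝ} (hx : 2 * Δ ≤ x) (hz : 2 * Δ ≤ z) :
    |bJ Δ T η x - bJ Δ T η z| ≤ |x - z| := by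
  wlog hxz : x ≤ z generalizing x z
  · rw [abs_sub_comm, abs_sub_comm x]
    exact this hz hx (le_of_not_ge hxz)
  have hx0 : 0 < x := by linarith
  have hz0 : 0 < z := by linarith
  have hL : 0 ≤ Real.log (x / Δ) := Real.log_nonneg (by rw [le_div_iff₀ hΔ]; linarith)
  have hLz : Real.log (x / Δ) ≤ Real.log (z / Δ) :=
    Real.log_le_log (by positivity) (div_le_div_of_nonneg_right hxz hΔ.le)
  have hs : Real.sqrt (Real.log (x / Δ) / η) ≤ Real.sqrt (Real.log (z / Δ) / η) :=
    Real.sqrt_le_sqrt (div_le_div_of_nonneg_right hLz hη.le)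
  have hs1 : η * Real.sqrt (Real.log (x / Δ) / η) ^ 2 = Real.log (x / Δ) := by
    rw [Real.sq_sqrt (by positivity)]
    field_simp
  have hs2 : η * Real.sqrt (Real.log (z / Δ) / η) ^ 2 = Real.log (z / Δ) := by
    rw [Real.sq_sqrt (div_nonneg (hL.trans hLz) hη.le)]
    field_simp
  have hs0 := Real.sqrt_nonneg (Real.log (x / Δ) / η)
  refine (abs_max_sub_max_le_abs _ _ _).trans ?_
  rw [chi, chi, abs_sub_comm x, abs_of_nonneg (sub_nonneg.2 hxz)]
  have hχx := hχ x hx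
  rw [← hs1] at hχx
  have hdiff : Real.log (z / Δ) - Real.log (x / Δ) ≤ (z - x) / x := by
    have h := Real.log_le_sub_one_of_pos (div_pos hz0 hx0)
    rw [Real.log_div hz0.ne' hx0.ne'] at h
    rw [Real.log_div hz0.ne' hΔ.ne', Real.log_div hx0.ne' hΔ.ne', sub_div, div_self hx0.ne']
    linarith
  rw [le_div_iff₀ hx0, ← hs1, ← hs2] at hdiff
  generalize Real.sqrt (Real.log (x / Δ) / η) = s at *
  generalize Real.sqrt (Real.log (z / Δ) / η) = t at *
  have hbig : 1 ≤ 3 * η * x * s := by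
    by_contra! h
    nlinarith [show 0 ≤ 3 * η * x * s by positivity]
  have hst : t - s ≤ 3 / 2 * (z - x) := by
    have h : (t - s) * (2 * (η * x * s)) ≤ z - x := by
      have : 0 ≤ η * x * (t - s) ^ 2 := by positivity
      linarith
    nlinarith
  rw [abs_le]
  constructor <;> linarith

/-- assume `2·T_AJ > e²·Δ` and `36·η·Δ²·log 2 > 1` (with `η = c_T·P·log 2`),
so that `9·η·x²·log(x/Δ) > 1` for all `x ≥ 2Δ`.  Then from every starting point
`(x⁰,y⁰) ∈ [2Δ,∞) × [0,∞)` the best response dynamics `x⁽ⁱ⁾ = b_T(y⁽ⁱ⁻¹⁾)`,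
`y⁽ⁱ⁾ = b_J(x⁽ⁱ⁻¹⁾)` converges to the unique Nash equilibrium of the jamming game. -/
theorem stmt_11 (Δ T_AJ P c_T η : ℝ)
    (hΔ : 0 < Δ) (hT : 0 < T_AJ) (hP : 0 < P) (hc : 0 < c_T)
    (hη : η = c_T * P * Real.log 2)
    (h1 : Real.exp 1 ^ 2 * Δ < 2 * T_AJ)
    (h2 : 1 < 36 * η * Δ ^ 2 * Real.log 2)
    (bT : ℝ → ℝ)
    (hbT : ∀ y : ℝ, 0 ≤ y → Real.exp 1 * Δ < bT y ∧
      bT y * Real.log (bT y / (Real.exp 1 * Δ)) = 2 * (T_AJ + y))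
    (x0 y0 : ℝ) (hx0 : 2 * Δ ≤ x0) (hy0 : 0 ≤ y0)
    (xs ys : ℕ → ℝ)
    (hxs0 : xs 0 = x0) (hys0 : ys 0 = y0)
    (hxsS : ∀ i : ℕ, xs (i + 1) = bT (ys i))
    (hysS : ∀ i : ℕ, ys (i + 1) = bJ Δ T_AJ η (xs i)) :
    (∀ x : ℝ, 2 * Δ ≤ x → 1 < 9 * η * x ^ 2 * Real.log (x / Δ)) ∧
    ∃ xe ye : ℝ, IsNE Δ T_AJ P c_T xe ye ∧
      (∀ x' y' : ℝ, IsNE Δ T_AJ P c_T x' y' → x' = xe ∧ y' = ye) ∧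
      Filter.Tendsto xs Filter.atTop (nhds xe) ∧
      Filter.Tendsto ys Filter.atTop (nhds ye) := by
  have hl2 : 0 < Real.log 2 := Real.log_pos one_lt_two
  have hη0 : 0 < η := by rw [hη]; positivity
  have he2 : 2 < Real.exp 1 := by linarith [Real.exp_one_gt_d9]
  have hχ : ∀ x : ℝ, 2 * Δ ≤ x → 1 < 9 * η * x ^ 2 * Real.log (x / Δ) := by
    intro x hx
    have hL : Real.log 2 ≤ Real.log (x / Δ) :=
      Real.log_le_log two_pos (by rwa [le_div_iff₀ hΔ])
    calc 1 < 9 * η * (2 * Δ) ^ 2 * Real.log 2 := by linarith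
      _ ≤ 9 * η * x ^ 2 * Real.log (x / Δ) := by gcongr
  have hbT2 (y : ℝ) (hy : 0 ≤ y) : 2 * Δ ≤ bT y := by nlinarith [(hbT y hy).1]
  have hbJ0 (x : ℝ) : 0 ≤ bJ Δ T_AJ η x := le_max_right _ _
  obtain ⟨k, hk0, hk1, hk⟩ := exists_abs_bT_sub_le hΔ h1 hbT
  have hJ {x z : ℝ} (hx : 2 * Δ ≤ x) (hz : 2 * Δ ≤ z) :=
    abs_bJ_sub_le (T := T_AJ) hΔ hη0 hχ hx hz
  have hF : ContractingWith ⟨k, hk0.le⟩ fun y : ℝ => bJ Δ T_AJ η (bT (max y 0)) := by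
    refine ⟨hk1, LipschitzWith.of_dist_le_mul fun y z => ?_⟩
    rw [Real.dist_eq, Real.dist_eq]
    have hy := le_max_right y 0
    have hz := le_max_right z 0
    exact (hJ (hbT2 _ hy) (hbT2 _ hz)).trans ((hk _ _ hy hz).trans
      (mul_le_mul_of_nonneg_left (abs_max_sub_max_le_abs y z 0) hk0.le))
  obtain ⟨ye, hfix⟩ : ∃ ye, bJ Δ T_AJ η (bT (max ye 0)) = ye := ⟨_, hF.fixedPoint_isFixedPt⟩
  have hye : 0 ≤ ye := hfix ▸ hbJ0 _
  rw [max_eq_left hye] at hfix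
  have hxe := hbT2 ye hye
  refine ⟨hχ, bT ye, ye, ⟨hxe, hye, fun x hx => ?_, fun y hy => ?_⟩, ?_, ?_⟩
  · rcases eq_or_ne x (bT ye) with rfl | hne
    · exact le_rfl
    · exact (UT_lt_UT_of_stationary hΔ hT hye (hbT ye hye).1 (hbT ye hye).2
        (by linarith) hne).le
  · rcases eq_or_ne y ye with rfl | hne
    · exact le_rfl
    · have := UJ_lt_UJ_bJ hΔ hT hη0 hη hxe hy (hfix.symm ▸ hne)
      rw [hfix] at this
      exact this.le
  · rintro x' y' ⟨hx', hy', hUT, hUJ⟩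
    have hx : x' = bT y' := by
      by_contra hne
      exact (hUT _ (hbT2 y' hy')).not_gt (UT_lt_UT_of_stationary hΔ hT hy' (hbT y' hy').1
        (hbT y' hy').2 (by linarith) hne)
    have hy : y' = bJ Δ T_AJ η x' := by
      by_contra hne
      exact (hUJ _ (hbJ0 x')).not_gt (UJ_lt_UJ_bJ hΔ hT hη0 hη hx' hy' hne)
    have h := (hJ hx' hxe).trans (hx ▸ hk y' ye hy' hye)
    rw [← hy, hfix] at h
    have hyy : y' = ye := by
      have : |y' - ye| = 0 := by nlinarith [abs_nonneg (y' - ye)]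
      exact sub_eq_zero.1 (abs_eq_zero.1 this)
    exact ⟨hyy ▸ hx, hyy⟩
  · have hys (i : ℕ) : 0 ≤ ys i := by
      cases i with
      | zero => rwa [hys0]
      | succ i => rw [hysS]; exact hbJ0 _
    have hxs (i : ℕ) : 2 * Δ ≤ xs i := by
      cases i with
      | zero => rwa [hxs0]
      | succ i => rw [hxsS]; exact hbT2 _ (hys i)
    set r := Real.sqrt k with hr
    have hr0 : 0 < r := Real.sqrt_pos.2 hk0
    have hrk : r * r = k := Real.mul_self_sqrt hk0.le
    have hr1 : r < 1 := by nlinarith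
    have hgeom (i : ℕ) : |xs i - bT ye| + r * |ys i - ye| ≤
        r ^ i * (|xs 0 - bT ye| + r * |ys 0 - ye|) := by
      induction i with
      | zero => simp
      | succ i ih =>
        have hx := hk (ys i) ye (hys i) hye
        have hy := hJ (hxs i) hxe
        rw [← hxsS, ← hrk] at hx
        rw [← hysS, hfix] at hy
        calc |xs (i + 1) - bT ye| + r * |ys (i + 1) - ye|
            ≤ r * r * |ys i - ye| + r * |xs i - bT ye| :=
              add_le_add hx (mul_le_mul_of_nonneg_left hy hr0.le)
          _ = r * (|xs i - bT ye| + r * |ys i - ye|) := by ring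
          _ ≤ r * (r ^ i * (|xs 0 - bT ye| + r * |ys 0 - ye|)) :=
              mul_le_mul_of_nonneg_left ih hr0.le
          _ = r ^ (i + 1) * (|xs 0 - bT ye| + r * |ys 0 - ye|) := by ring
    have hlim : Filter.Tendsto (fun i : ℕ => r ^ i * (|xs 0 - bT ye| + r * |ys 0 - ye|))
        Filter.atTop (nhds 0) := by
      simpa using (tendsto_pow_atTop_nhds_zero_of_lt_one hr0.le hr1).mul_const
        (|xs 0 - bT ye| + r * |ys 0 - ye|)
    constructor <;> rw [tendsto_iff_dist_tendsto_zero]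
    · refine squeeze_zero (fun _ => dist_nonneg) (fun i => ?_) hlim
      rw [Real.dist_eq]
      exact (le_add_of_nonneg_right (by positivity)).trans (hgeom i)
    · refine squeeze_zero (fun _ => dist_nonneg) (fun i => ?_) (by simpa using hlim.div_const r)
      rw [Real.dist_eq, le_div_iff₀ hr0, mul_comm]
      exact (le_add_of_nonneg_left (abs_nonneg _)).trans (hgeom i)
end

section
/- There exists a unique x̂ > Δ satisfying η·x̂²·log(x̂/Δ) = 1 (with η := c_T·P·log 2); moreover the function χ(x) := √(log(x/Δ)/η) − T_AJ − x/2 is strictly increasing on (Δ, x̂], strictly decreasing on [x̂, ∞), and hence attains its maximum over (Δ, ∞) exactly at x̂. -/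
lemma log_div_pos {Δ x : ℝ} (hΔ : 0 < Δ) (hx : Δ < x) : 0 < Real.log (x / Δ) :=
  Real.log_pos ((one_lt_div hΔ).2 hx)

lemma strictMonoOn_mul_sq_mul_log_div {Δ η : ℝ} (hΔ : 0 < Δ) (hη : 0 < η) :
    StrictMonoOn (fun x => η * x ^ 2 * Real.log (x / Δ)) (Set.Ioi Δ) := by
  intro a ha b hb hab
  have ha0 : 0 < a := hΔ.trans ha
  have hlog : Real.log (a / Δ) < Real.log (b / Δ) :=
    Real.log_lt_log (by positivity) (by gcongr)
  have hpos := log_div_pos hΔ ha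
  dsimp only
  gcongr

lemma exists_mul_sq_mul_log_div_eq_one {Δ η : ℝ} (hΔ : 0 < Δ) (hη : 0 < η) :
    ∃ x, Δ < x ∧ η * x ^ 2 * Real.log (x / Δ) = 1 := by
  set M := Δ * Real.exp (1 / (η * Δ ^ 2)) with hM
  have hΔM : Δ ≤ M := le_mul_of_one_le_right hΔ.le (Real.one_le_exp (by positivity))
  have hcont : ContinuousOn (fun x => η * x ^ 2 * Real.log (x / Δ)) (Set.Icc Δ M) := by
    refine ContinuousOn.mul (by fun_prop) (ContinuousOn.log (by fun_prop) fun x hx => ?_)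
    exact (div_pos (hΔ.trans_le hx.1) hΔ).ne'
  have hMlog : Real.log (M / Δ) = 1 / (η * Δ ^ 2) := by
    rw [hM, mul_div_cancel_left₀ _ hΔ.ne', Real.log_exp]
  have hone : 1 ≤ η * M ^ 2 * Real.log (M / Δ) := by
    rw [hMlog, mul_one_div, one_le_div (by positivity)]
    gcongr
  obtain ⟨x, hx, hgx⟩ := intermediate_value_Icc hΔM hcont
    (show (1 : ℝ) ∈ Set.Icc _ _ from ⟨by simp [div_self hΔ.ne'], hone⟩)
  refine ⟨x, lt_of_le_of_ne hx.1 ?_, hgx⟩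
  rintro rfl
  simp [div_self hΔ.ne'] at hgx

lemma hasDerivAt_chi {Δ T_AJ η x : ℝ} (hΔ : 0 < Δ) (hη : 0 < η) (hx : Δ < x) :
    HasDerivAt (chi Δ T_AJ η)
      ((1 / √(η * x ^ 2 * Real.log (x / Δ)) - 1) / 2) x := by
  have hx0 : 0 < x := hΔ.trans hx
  have hlog := log_div_pos hΔ hx
  have hderiv := (((((hasDerivAt_id x).div_const Δ).log (div_pos hx0 hΔ).ne').div_const η).sqrt
    (div_pos hlog hη).ne').sub_const T_AJ |>.sub ((hasDerivAt_id x).div_const 2)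
  refine hderiv.congr_deriv ?_
  have hsqrt : √(η * x ^ 2 * Real.log (x / Δ)) = η * x * √(Real.log (x / Δ) / η) := by
    rw [← Real.sqrt_sq (by positivity : 0 ≤ η * x), ← Real.sqrt_mul (sq_nonneg _)]
    congr 1
    field_simp
  have hs : 0 < √(Real.log (x / Δ) / η) := Real.sqrt_pos.2 (div_pos hlog hη)
  rw [hsqrt]
  simp only [id_eq]
  field_simp

/-- there exists a unique `x̂ > Δ` with `η·x̂²·log(x̂/Δ) = 1`
(where `η = c_T·P·log 2`); moreover `χ` is strictly increasing on `(Δ, x̂]`, strictly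
decreasing on `[x̂, ∞)`, and attains its maximum over `(Δ, ∞)` exactly at `x̂`. -/
theorem stmt_12 (Δ T_AJ P c_T η : ℝ)
    (hΔ : 0 < Δ) (hT : 0 < T_AJ) (hP : 0 < P) (hc : 0 < c_T)
    (hη : η = c_T * P * Real.log 2) :
    ∃ xhat : ℝ,
      (Δ < xhat ∧ η * xhat ^ 2 * Real.log (xhat / Δ) = 1) ∧
      (∀ z : ℝ, Δ < z → η * z ^ 2 * Real.log (z / Δ) = 1 → z = xhat) ∧
      StrictMonoOn (fun x => chi Δ T_AJ η x) (Set.Ioc Δ xhat) ∧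
      StrictAntiOn (fun x => chi Δ T_AJ η x) (Set.Ici xhat) ∧
      (∀ x : ℝ, Δ < x → x ≠ xhat → chi Δ T_AJ η x < chi Δ T_AJ η xhat) := by
  have hη0 : 0 < η := hη ▸ mul_pos (mul_pos hc hP) (Real.log_pos one_lt_two)
  have hmono := strictMonoOn_mul_sq_mul_log_div hΔ hη0
  obtain ⟨xhat, hx, hg⟩ := exists_mul_sq_mul_log_div_eq_one hΔ hη0
  have hgpos : ∀ x, Δ < x → 0 < √(η * x ^ 2 * Real.log (x / Δ)) := fun x hxΔ => by
    have := log_div_pos hΔ hxΔ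
    have := hΔ.trans hxΔ
    positivity
  have hinc : StrictMonoOn (chi Δ T_AJ η) (Set.Ioc Δ xhat) := by
    refine strictMonoOn_of_deriv_pos (convex_Ioc _ _)
      (fun y hy => (hasDerivAt_chi hΔ hη0 hy.1).continuousAt.continuousWithinAt) fun y hy => ?_
    rw [interior_Ioc] at hy
    rw [(hasDerivAt_chi hΔ hη0 hy.1).deriv]
    have hlt : η * y ^ 2 * Real.log (y / Δ) < 1 := hg ▸ hmono hy.1 hx hy.2
    have hsqrt := (Real.sqrt_lt' one_pos).2 (hlt.trans_eq (one_pow 2).symm)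
    linarith [(one_lt_div (hgpos y hy.1)).2 hsqrt]
  have hdec : StrictAntiOn (chi Δ T_AJ η) (Set.Ici xhat) := by
    refine strictAntiOn_of_deriv_neg (convex_Ici _)
      (fun y hy => (hasDerivAt_chi hΔ hη0
        (hx.trans_le hy)).continuousAt.continuousWithinAt) fun y hy => ?_
    rw [interior_Ici] at hy
    have hyΔ : Δ < y := hx.trans hy
    rw [(hasDerivAt_chi hΔ hη0 hyΔ).deriv]
    have hlt : 1 < η * y ^ 2 * Real.log (y / Δ) := hg ▸ hmono hx hyΔ hy
    have hsqrt := (Real.lt_sqrt zero_le_one).2 ((one_pow 2).trans_lt hlt)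
    linarith [(div_lt_one (hgpos y hyΔ)).2 hsqrt]
  refine ⟨xhat, ⟨hx, hg⟩, fun z hz hgz => hmono.injOn hz hx (hgz.trans hg.symm), hinc, hdec,
    fun x hxΔ hne => ?_⟩
  rcases hne.lt_or_gt with hlt | hgt
  · exact hinc ⟨hxΔ, hlt.le⟩ ⟨hx, le_rfl⟩ hlt
  · exact hdec Set.self_mem_Ici hgt.le hgt
end

section
/- Let x_m := b_T(0), let y_M := max(χ(x̂), 0) where x̂ > Δ is the unique solution of η·x̂²·log(x̂/Δ) = 1, and let x_M := b_T(y_M). Then for every starting point (x⁰, y⁰) ∈ [2Δ, ∞) × [0, ∞), the best response dynamics x^(i) := b_T(y^(i−1)), y^(i) := b_J(x^(i−1)) satisfies x^(i) ∈ [x_m, x_M] and y^(i) ∈ [0, y_M] for all i ≥ 2; that is, the dynamics enters the restricted strategy set S′ := [x_m, x_M] × [0, y_M] in at most two iterations and remains there. -/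
/-- A point `xhat` with `η·xhat²·log(xhat/Δ) = 1` maximizes `χ` over `[Δ, ∞)`. -/
theorem chi_le_chi_of_eq_one {Δ T_AJ η xhat x : ℝ} (hΔ : 0 < Δ) (hη : 0 < η)
    (hxhat : Δ < xhat) (h : η * xhat ^ 2 * Real.log (xhat / Δ) = 1) (hx : Δ ≤ x) :
    chi Δ T_AJ η x ≤ chi Δ T_AJ η xhat := by
  have hxhat0 : 0 < xhat := hΔ.trans hxhat
  have hx0 : 0 < x := hΔ.trans_le hx
  have hL : 0 ≤ Real.log (x / Δ) := Real.log_nonneg ((one_le_div hΔ).2 hx)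
  have hsqrt : √(Real.log (xhat / Δ) / η) = 1 / (η * xhat) := by
    rw [Real.sqrt_eq_iff_mul_self_eq_of_pos (by positivity)]
    field_simp
    linarith
  have htangent : Real.log (x / Δ) ≤ Real.log (xhat / Δ) + (x / xhat - 1) := by
    have := Real.log_le_sub_one_of_pos (div_pos hx0 hxhat0)
    rw [Real.log_div hx0.ne' hxhat0.ne'] at this
    rw [Real.log_div hx0.ne' hΔ.ne', Real.log_div hxhat0.ne' hΔ.ne']
    linarith
  have hlog : Real.log (xhat / Δ) = 1 / (η * xhat ^ 2) := by
    field_simp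
    linarith
  have hle : √(Real.log (x / Δ) / η) ≤ 1 / (η * xhat) + (x - xhat) / 2 := by
    have hs := Real.sq_sqrt (div_nonneg hL hη.le)
    set s := √(Real.log (x / Δ) / η)
    set t := 1 / (η * xhat) with ht
    have ht0 : 0 < t := by positivity
    have hst : s ^ 2 ≤ t ^ 2 + t * (x - xhat) := by
      rw [hs, div_le_iff₀ hη]
      have : (t ^ 2 + t * (x - xhat)) * η = 1 / (η * xhat ^ 2) + (x / xhat - 1) := by
        rw [ht]
        field_simp
      linarith
    nlinarith [sq_nonneg (s - t)]
  unfold chi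
  rw [hsqrt]
  linarith

/-- `x ↦ x·log(x/c)` is strictly increasing on `(c, ∞)`. -/
theorem mul_log_div_lt_mul_log_div {c a b : ℝ} (hc : 0 < c) (ha : c < a) (hab : a < b) :
    a * Real.log (a / c) < b * Real.log (b / c) :=
  have ha0 : 0 < a := hc.trans ha
  mul_lt_mul'' hab (Real.log_lt_log (by positivity) (by gcongr)) ha0.le
    (Real.log_pos ((one_lt_div hc).2 ha)).le

/-- with `x_m := b_T(0)`, `y_M := max(χ(x̂), 0)` (where `x̂ > Δ` is the unique
solution of `η·x̂²·log(x̂/Δ) = 1`) and `x_M := b_T(y_M)`, from every starting point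
`(x⁰,y⁰) ∈ [2Δ,∞) × [0,∞)` the best response dynamics satisfies
`x⁽ⁱ⁾ ∈ [x_m, x_M]` and `y⁽ⁱ⁾ ∈ [0, y_M]` for all `i ≥ 2`: the dynamics enters the
restricted strategy set `S′ = [x_m, x_M] × [0, y_M]` in at most two iterations and stays. -/
theorem stmt_13 (Δ T_AJ P c_T η : ℝ)
    (hΔ : 0 < Δ) (hT : 0 < T_AJ) (hP : 0 < P) (hc : 0 < c_T)
    (hη : η = c_T * P * Real.log 2)
    (bT : ℝ → ℝ)
    (hbT : ∀ y : ℝ, 0 ≤ y → Real.exp 1 * Δ < bT y ∧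
      bT y * Real.log (bT y / (Real.exp 1 * Δ)) = 2 * (T_AJ + y))
    (xhat : ℝ) (hxhat : Δ < xhat)
    (hxhateq : η * xhat ^ 2 * Real.log (xhat / Δ) = 1)
    (hxhatuniq : ∀ z : ℝ, Δ < z → η * z ^ 2 * Real.log (z / Δ) = 1 → z = xhat)
    (x0 y0 : ℝ) (hx0 : 2 * Δ ≤ x0) (hy0 : 0 ≤ y0)
    (xs ys : ℕ → ℝ)
    (hxs0 : xs 0 = x0) (hys0 : ys 0 = y0)
    (hxsS : ∀ i : ℕ, xs (i + 1) = bT (ys i))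
    (hysS : ∀ i : ℕ, ys (i + 1) = bJ Δ T_AJ η (xs i)) :
    ∀ i : ℕ, 2 ≤ i →
      xs i ∈ Set.Icc (bT 0) (bT (max (chi Δ T_AJ η xhat) 0)) ∧
      ys i ∈ Set.Icc (0 : ℝ) (max (chi Δ T_AJ η xhat) 0) := by
  have hη0 : 0 < η := by
    have := Real.log_pos one_lt_two
    rw [hη]
    positivity
  have hmono : ∀ y z : ℝ, 0 ≤ y → y ≤ z → bT y ≤ bT z := by
    intro y z hy hyz
    by_contra! hlt
    obtain ⟨-, hy'⟩ := hbT y hy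
    obtain ⟨hz, hz'⟩ := hbT z (hy.trans hyz)
    have := mul_log_div_lt_mul_log_div (by positivity) hz hlt
    linarith
  have hys : ∀ i, 0 ≤ ys i := by
    rintro (_ | i)
    · rwa [hys0]
    · rw [hysS]
      exact le_max_right _ _
  have hxs : ∀ i, Δ ≤ xs i := by
    rintro (_ | i)
    · linarith
    · rw [hxsS]
      have := (hbT _ (hys i)).1
      nlinarith [Real.add_one_le_exp 1]
  have hysM : ∀ i, ys (i + 1) ≤ max (chi Δ T_AJ η xhat) 0 := by
    intro i
    rw [hysS]
    exact max_le_max_right 0 (chi_le_chi_of_eq_one hΔ hη0 hxhat hxhateq (hxs i))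
  intro i hi
  obtain ⟨k, rfl⟩ := Nat.exists_eq_add_of_le' hi
  refine ⟨?_, hys _, hysM _⟩
  rw [hxsS]
  exact ⟨hmono _ _ le_rfl (hys _), hmono _ _ (hys _) (hysM _)⟩
end

section
/- Let x_m := b_T(0), i.e., the unique x > e·Δ with x·log(x/(e·Δ)) = 2·T_AJ. Assume 2·T_AJ > e²·Δ and 9·η·x_m²·log(x_m/Δ) > 1 (with η := c_T·P·log 2). Then 9·η·x²·log(x/Δ) > 1 for all x ≥ x_m, and from every starting point (x⁰, y⁰) ∈ [2Δ, ∞) × [0, ∞) the best response dynamics x^(i) := b_T(y^(i−1)), y^(i) := b_J(x^(i−1)) converges to the unique Nash equilibrium of the jamming game. -/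
/-- The first-order condition characterising the target node's best response maximises `UT`,
and the maximiser is unique. -/
lemma UT_lt_of_ne {Δ T_AJ x y z : ℝ} (hΔ : 0 < Δ) (hT : 0 < T_AJ) (hy : 0 ≤ y)
    (hx : 0 < x) (hL : 0 < Real.log (x / Δ)) (hz : 0 < z)
    (hxy : x * (Real.log (x / Δ) - 1) = 2 * (T_AJ + y)) (hne : z ≠ x) :
    UT Δ T_AJ z y < UT Δ T_AJ x y := by
  have hlog : Real.log (z / Δ) < Real.log (x / Δ) - 1 + z / x := by
    have h := Real.log_lt_sub_one_of_pos (div_pos hz hx) (by rwa [Ne, div_eq_one_iff_eq hx.ne'])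
    rw [Real.log_div hz.ne' hx.ne'] at h
    rw [Real.log_div hz.ne' hΔ.ne', Real.log_div hx.ne' hΔ.ne']
    linarith
  have hx' : T_AJ + y + x / 2 = x * Real.log (x / Δ) / 2 := by linarith
  have hz' : T_AJ + y + z / 2 = x * (Real.log (x / Δ) - 1 + z / x) / 2 := by
    field_simp
    linarith
  have h2 : 0 < Real.log 2 := Real.log_pos one_lt_two
  have hD : 0 < T_AJ + y + z / 2 := by positivity
  unfold UT Cap Real.logb
  rw [hx', div_lt_div_iff₀ hD (by positivity), hz']
  rw [div_mul_eq_mul_div, div_mul_eq_mul_div]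
  apply div_lt_div_of_pos_right _ h2
  have := mul_lt_mul_of_pos_right hlog (by positivity : 0 < x * Real.log (x / Δ) / 2)
  linarith

/-- The jammer's best response maximises `UJ`, and the maximiser is unique. -/
lemma UJ_lt_of_ne {Δ T_AJ P c_T η x y : ℝ} (hT : 0 < T_AJ)
    (hη : η = c_T * P * Real.log 2) (hη0 : 0 < η) (hx : 0 < x)
    (hL : 0 < Real.log (x / Δ)) (hy : 0 ≤ y) (hne : y ≠ bJ Δ T_AJ η x) :
    UJ Δ T_AJ P c_T x y < UJ Δ T_AJ P c_T x (bJ Δ T_AJ η x) := by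
  have h2 : 0 < Real.log 2 := Real.log_pos one_lt_two
  have hb0 : 0 ≤ bJ Δ T_AJ η x := le_max_right _ _
  set b := bJ Δ T_AJ η x with hb
  set r := Real.sqrt (Real.log (x / Δ) / η) with hr
  have hr0 : 0 ≤ r := Real.sqrt_nonneg _
  have hrsq : η * r ^ 2 = Real.log (x / Δ) := by
    rw [hr, Real.sq_sqrt (by positivity)]
    field_simp
  have hbr : r - T_AJ - x / 2 ≤ b := le_max_left _ _
  have hD : 0 < T_AJ + y + x / 2 := by positivity
  have hs : 0 < T_AJ + b + x / 2 := by positivity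
  have key : 0 < (y - b) * (η * (T_AJ + y + x / 2) * (T_AJ + b + x / 2) - η * r ^ 2) := by
    rcases lt_or_gt_of_ne hne with h | h
    · have hbe : b = r - T_AJ - x / 2 := by
        rcases max_choice (chi Δ T_AJ η x) 0 with h' | h'
        · exact h'
        · exact absurd (hb.trans h') (by linarith)
      have hre : r = T_AJ + b + x / 2 := by linarith
      rw [hre]
      have : 0 < (b - y) * (b - y) * η * (T_AJ + b + x / 2) := by
        have := sub_pos.2 h
        positivity
      linarith
    · have h1 : η * r ^ 2 ≤ η * (T_AJ + b + x / 2) ^ 2 := by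
        gcongr
        linarith
      have h3 : 0 < η * (T_AJ + b + x / 2) * (y - b) := mul_pos (mul_pos hη0 hs) (sub_pos.2 h)
      apply mul_pos (sub_pos.2 h)
      linarith
  rw [hrsq] at key
  have hdiff : UJ Δ T_AJ P c_T x b - UJ Δ T_AJ P c_T x y =
      (y - b) * (η * (T_AJ + y + x / 2) * (T_AJ + b + x / 2) - Real.log (x / Δ)) /
        (Real.log 2 * (T_AJ + y + x / 2) * (T_AJ + b + x / 2)) := by
    unfold UJ Cap Real.logb
    obtain ⟨u, hu⟩ : ∃ u, u = T_AJ + y + x / 2 := ⟨_, rfl⟩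
    obtain ⟨v, hv⟩ : ∃ v, v = T_AJ + b + x / 2 := ⟨_, rfl⟩
    have hy' : y = u - T_AJ - x / 2 := by linarith
    have hb' : b = v - T_AJ - x / 2 := by linarith
    rw [← hu] at hD
    rw [← hv] at hs
    rw [← hu, ← hv, hy', hb', hη]
    field_simp
    ring
  have : 0 < UJ Δ T_AJ P c_T x b - UJ Δ T_AJ P c_T x y := by
    rw [hdiff]
    positivity
  linarith

/-- Tangent-line bound for the convex function `x ↦ x (log (x/Δ) - 1)`. -/
lemma log_mul_sub_le {Δ a b : ℝ} (hΔ : 0 < Δ) (ha : 0 < a) (hb : 0 < b) :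
    Real.log (b / Δ) * (a - b) ≤
      a * (Real.log (a / Δ) - 1) - b * (Real.log (b / Δ) - 1) := by
  have h := Real.log_le_sub_one_of_pos (div_pos hb ha)
  have h' := mul_le_mul_of_nonneg_left h ha.le
  rw [Real.log_div hb.ne' ha.ne', mul_sub, mul_sub, mul_div_cancel₀ _ ha.ne'] at h'
  rw [Real.log_div hb.ne' hΔ.ne', Real.log_div ha.ne' hΔ.ne']
  linarith

/-- Where `9 η x² log (x/Δ) > 1`, the jammer's unconstrained best response is `1`-Lipschitz. -/
lemma abs_chi_sub_le {Δ T_AJ η a b : ℝ} (hΔ : 0 < Δ) (hη0 : 0 < η) (hb : 0 < b) (hab : b ≤ a)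
    (hL : 0 < Real.log (b / Δ)) (h : 1 < 9 * η * b ^ 2 * Real.log (b / Δ)) :
    |chi Δ T_AJ η a - chi Δ T_AJ η b| ≤ a - b := by
  have ha : 0 < a := hb.trans_le hab
  have hLL : Real.log (b / Δ) ≤ Real.log (a / Δ) := Real.log_le_log (by positivity) (by gcongr)
  have hlog : Real.log (a / Δ) - Real.log (b / Δ) ≤ (a - b) / b := by
    have h := Real.log_le_sub_one_of_pos (div_pos ha hb)
    rw [Real.log_div ha.ne' hb.ne'] at h
    rw [Real.log_div hb.ne' hΔ.ne', Real.log_div ha.ne' hΔ.ne', sub_div, div_self hb.ne']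
    linarith
  set A := Real.sqrt (Real.log (a / Δ) / η) with hA
  set B := Real.sqrt (Real.log (b / Δ) / η) with hB
  have hB0 : 0 < B := Real.sqrt_pos.2 (by positivity)
  have hAB : B ≤ A := Real.sqrt_le_sqrt (by gcongr)
  have hA2 : η * A ^ 2 = Real.log (a / Δ) := by
    rw [hA, Real.sq_sqrt (div_nonneg (hL.le.trans hLL) hη0.le)]
    field_simp
  have hB2 : η * B ^ 2 = Real.log (b / Δ) := by
    rw [hB, Real.sq_sqrt (by positivity)]
    field_simp
  have hηbB : 1 < 3 * (η * b * B) := by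
    rw [← hB2] at h
    have : (1 : ℝ) < (3 * (η * b * B)) ^ 2 := by linarith
    nlinarith [mul_pos (mul_pos hη0 hb) hB0]
  have hup : A - B ≤ 3 / 2 * (a - b) := by
    rw [← hA2, ← hB2, le_div_iff₀ hb] at hlog
    have h1 : 2 * (η * b * B) * (A - B) ≤ a - b := by
      have : 0 ≤ η * b * ((A - B) * (A - B)) := by positivity
      linarith
    have h2 : (A - B) * 1 ≤ (A - B) * (3 * (η * b * B)) :=
      mul_le_mul_of_nonneg_left hηbB.le (sub_nonneg.2 hAB)
    linarith
  unfold chi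
  rw [← hA, ← hB, abs_le]
  constructor <;> linarith

/-- A sequence with convergent even- and odd-indexed subsequences of the same limit converges. -/
lemma tendsto_of_tendsto_even_odd {u : ℕ → ℝ} {l : ℝ}
    (he : Filter.Tendsto (fun n => u (2 * n)) Filter.atTop (nhds l))
    (ho : Filter.Tendsto (fun n => u (2 * n + 1)) Filter.atTop (nhds l)) :
    Filter.Tendsto u Filter.atTop (nhds l) := by
  rw [Metric.tendsto_atTop] at *
  intro ε hε
  obtain ⟨M, hM⟩ := he ε hε
  obtain ⟨N, hN⟩ := ho ε hε
  refine ⟨2 * (M + N) + 1, fun n hn => ?_⟩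
  rcases Nat.even_or_odd' n with ⟨k, rfl | rfl⟩
  · exact hM k (by omega)
  · exact hN k (by omega)

/-- let `x_m := b_T(0)` (the unique `x > e·Δ` with `x·log(x/(e·Δ)) = 2·T_AJ`);
assume `2·T_AJ > e²·Δ` and `9·η·x_m²·log(x_m/Δ) > 1` (with `η = c_T·P·log 2`).  Then
`9·η·x²·log(x/Δ) > 1` for all `x ≥ x_m`, and from every starting point
`(x⁰,y⁰) ∈ [2Δ,∞) × [0,∞)` the best response dynamics converges to the unique Nash
equilibrium of the jamming game. -/
theorem stmt_14 (Δ T_AJ P c_T η : ℝ)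
    (hΔ : 0 < Δ) (hT : 0 < T_AJ) (hP : 0 < P) (hc : 0 < c_T)
    (hη : η = c_T * P * Real.log 2)
    (h1 : Real.exp 1 ^ 2 * Δ < 2 * T_AJ)
    (bT : ℝ → ℝ)
    (hbT : ∀ y : ℝ, 0 ≤ y → Real.exp 1 * Δ < bT y ∧
      bT y * Real.log (bT y / (Real.exp 1 * Δ)) = 2 * (T_AJ + y))
    (h2 : 1 < 9 * η * (bT 0) ^ 2 * Real.log (bT 0 / Δ))
    (x0 y0 : ℝ) (hx0 : 2 * Δ ≤ x0) (hy0 : 0 ≤ y0)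
    (xs ys : ℕ → ℝ)
    (hxs0 : xs 0 = x0) (hys0 : ys 0 = y0)
    (hxsS : ∀ i : ℕ, xs (i + 1) = bT (ys i))
    (hysS : ∀ i : ℕ, ys (i + 1) = bJ Δ T_AJ η (xs i)) :
    (∀ x : ℝ, bT 0 ≤ x → 1 < 9 * η * x ^ 2 * Real.log (x / Δ)) ∧
    ∃ xe ye : ℝ, IsNE Δ T_AJ P c_T xe ye ∧
      (∀ x' y' : ℝ, IsNE Δ T_AJ P c_T x' y' → x' = xe ∧ y' = ye) ∧
      Filter.Tendsto xs Filter.atTop (nhds xe) ∧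
      Filter.Tendsto ys Filter.atTop (nhds ye) := by
  have hη0 : 0 < η := by
    rw [hη]
    have := Real.log_pos one_lt_two
    positivity
  have he : 0 < Real.exp 1 := Real.exp_pos 1
  have hbT0 : ∀ y, 0 ≤ y → 0 < bT y := fun y hy =>
    (by positivity : 0 < Real.exp 1 * Δ).trans (hbT y hy).1
  have hfoc : ∀ y, 0 ≤ y → bT y * (Real.log (bT y / Δ) - 1) = 2 * (T_AJ + y) := by
    intro y hy
    rw [← (hbT y hy).2, Real.log_div (hbT0 y hy).ne' hΔ.ne',
      Real.log_div (hbT0 y hy).ne' (by positivity), Real.log_mul he.ne' hΔ.ne', Real.log_exp]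
    ring
  have hL1 : ∀ y, 0 ≤ y → 1 < Real.log (bT y / Δ) := by
    intro y hy
    rw [Real.lt_log_iff_exp_lt (div_pos (hbT0 y hy) hΔ), lt_div_iff₀ hΔ]
    exact (hbT y hy).1
  have hlip : ∀ y z, 0 ≤ y → y ≤ z → Real.log (bT y / Δ) * (bT z - bT y) ≤ 2 * (z - y) := by
    intro y z hy hyz
    have := log_mul_sub_le hΔ (hbT0 z (hy.trans hyz)) (hbT0 y hy)
    rw [hfoc y hy, hfoc z (hy.trans hyz)] at this
    linarith
  have hmono : ∀ y z, 0 ≤ y → y ≤ z → bT y ≤ bT z := by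
    intro y z hy hyz
    have := log_mul_sub_le hΔ (hbT0 y hy) (hbT0 z (hy.trans hyz))
    rw [hfoc y hy, hfoc z (hy.trans hyz)] at this
    by_contra! hlt
    have := mul_pos (zero_lt_one.trans (hL1 z (hy.trans hyz))) (sub_pos.2 hlt)
    linarith
  have hlogmono : ∀ x, bT 0 ≤ x → Real.log (bT 0 / Δ) ≤ Real.log (x / Δ) := fun x hx =>
    Real.log_le_log (div_pos (hbT0 0 le_rfl) hΔ) (by gcongr)
  set Lm := Real.log (bT 0 / Δ) with hLm
  have hLm2 : 2 < Lm := by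
    by_contra! hle
    have hle' : bT 0 ≤ Real.exp 1 ^ 2 * Δ := by
      rw [hLm, Real.log_le_iff_le_exp (div_pos (hbT0 0 le_rfl) hΔ), div_le_iff₀ hΔ] at hle
      rwa [← Real.exp_nat_mul, Nat.cast_ofNat, mul_one]
    have h := hfoc 0 le_rfl
    have : bT 0 * (Lm - 1) ≤ bT 0 * 1 :=
      mul_le_mul_of_nonneg_left (by linarith) (hbT0 0 le_rfl).le
    linarith
  have hfirst : ∀ x : ℝ, bT 0 ≤ x → 1 < 9 * η * x ^ 2 * Real.log (x / Δ) := by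
    intro x hx
    refine h2.trans_le ?_
    have := hbT0 0 le_rfl
    have := hlogmono x hx
    gcongr
  refine ⟨hfirst, ?_⟩
  have hcontr : ∀ y z, 0 ≤ y → y ≤ z →
      |bJ Δ T_AJ η (bT z) - bJ Δ T_AJ η (bT y)| ≤ 2 / Lm * (z - y) := by
    intro y z hy hyz
    have hm := hmono 0 y le_rfl hy
    have hyz' := hmono y z hy hyz
    have hLy := hlogmono _ hm
    calc |bJ Δ T_AJ η (bT z) - bJ Δ T_AJ η (bT y)|
        ≤ |chi Δ T_AJ η (bT z) - chi Δ T_AJ η (bT y)| := abs_max_sub_max_le_abs _ _ _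
      _ ≤ bT z - bT y := abs_chi_sub_le hΔ hη0 (hbT0 y hy) hyz' (by linarith) (hfirst _ hm)
      _ ≤ 2 / Lm * (z - y) := by
        rw [div_mul_eq_mul_div, le_div_iff₀ (by linarith), mul_comm]
        exact (mul_le_mul_of_nonneg_right hLy (sub_nonneg.2 hyz')).trans (hlip y z hy hyz)
  -- The two-step map `bJ ∘ bT`, extended to all of `ℝ` by clamping at `0`, is a contraction.
  let F : ℝ → ℝ := fun y => bJ Δ T_AJ η (bT (max y 0))
  have hK0 : 0 ≤ 2 / Lm := by positivity
  have hF : ContractingWith (2 / Lm).toNNReal F := by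
    refine ⟨?_, LipschitzWith.of_dist_le_mul fun y z => ?_⟩
    · rw [Real.toNNReal_lt_one, div_lt_one (by linarith)]
      exact hLm2
    · rw [Real.coe_toNNReal _ hK0, Real.dist_eq, Real.dist_eq]
      refine le_trans ?_ (mul_le_mul_of_nonneg_left (abs_max_sub_max_le_abs y z 0) hK0)
      rcases le_total (max y 0) (max z 0) with h | h
      · rw [abs_sub_comm, abs_sub_comm (max y 0), abs_of_nonneg (sub_nonneg.2 h)]
        exact hcontr _ _ (le_max_right _ _) h
      · rw [abs_of_nonneg (sub_nonneg.2 h)]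
        exact hcontr _ _ (le_max_right _ _) h
  have hFeq : ∀ y, 0 ≤ y → F y = bJ Δ T_AJ η (bT y) := fun y hy => by
    simp only [F, max_eq_left hy]
  let ye := ContractingWith.fixedPoint F hF
  have hfix : F ye = ye := hF.fixedPoint_isFixedPt
  have hye : 0 ≤ ye := hfix ▸ le_max_right _ _
  have hbJe : bJ Δ T_AJ η (bT ye) = ye := (hFeq ye hye).symm.trans hfix
  have h2e : ∀ y, 0 ≤ y → 2 * Δ ≤ bT y := by
    intro y hy
    have h := mul_le_mul_of_nonneg_right (Real.add_one_le_exp 1) hΔ.le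
    have := (hbT y hy).1
    linarith
  have hys : ∀ i, 0 ≤ ys i := by
    rintro (_ | i)
    · rwa [hys0]
    · rw [hysS]
      exact le_max_right _ _
  have hstep : ∀ i, ys (i + 2) = F (ys i) := fun i => by
    rw [hFeq _ (hys i), ← hxsS, ← hysS]
  have hsub : ∀ k, Filter.Tendsto (fun n => ys (2 * n + k)) Filter.atTop (nhds ye) := by
    intro k
    have hiter : (fun n => ys (2 * n + k)) = fun n => F^[n] (ys k) := by
      funext n
      induction n with
      | zero => simp
      | succ n ih =>
        rw [Function.iterate_succ_apply', ← ih, ← hstep]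
        ring_nf
    rw [hiter]
    exact hF.tendsto_iterate_fixedPoint _
  have hysT : Filter.Tendsto ys Filter.atTop (nhds ye) :=
    tendsto_of_tendsto_even_odd (hsub 0) (hsub 1)
  have hbTdist : ∀ y z, 0 ≤ y → 0 ≤ z → dist (bT y) (bT z) ≤ 2 * dist y z := by
    have aux : ∀ y z, 0 ≤ y → y ≤ z → bT z - bT y ≤ 2 * (z - y) := fun y z hy hyz => by
      have := mul_le_mul_of_nonneg_right (hL1 y hy).le (sub_nonneg.2 (hmono y z hy hyz))
      have := hlip y z hy hyz
      linarith
    intro y z hy hz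
    rw [Real.dist_eq, Real.dist_eq]
    rcases le_total y z with h | h
    · rw [abs_sub_comm, abs_sub_comm y, abs_of_nonneg (sub_nonneg.2 h),
        abs_of_nonneg (sub_nonneg.2 (hmono y z hy h))]
      exact aux y z hy h
    · rw [abs_of_nonneg (sub_nonneg.2 h), abs_of_nonneg (sub_nonneg.2 (hmono z y hz h))]
      exact aux z y hz h
  refine ⟨bT ye, ye, ⟨h2e ye hye, hye, fun x hx => ?_, fun y hy => ?_⟩, ?_, ?_, hysT⟩
  · by_cases hne : x = bT ye
    · rw [hne]
    · exact (UT_lt_of_ne hΔ hT hye (hbT0 ye hye) (by linarith [hL1 ye hye]) (by linarith)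
        (hfoc ye hye) hne).le
  · by_cases hne : y = ye
    · rw [hne]
    · have := UJ_lt_of_ne hT hη hη0 (hbT0 ye hye) (by linarith [hL1 ye hye]) hy
        (by rwa [hbJe])
      rw [hbJe] at this
      exact this.le
  · rintro x' y' ⟨hx', hy', hUT, hUJ⟩
    have hx : x' = bT y' := by
      by_contra hne
      exact (hUT _ (h2e y' hy')).not_gt (UT_lt_of_ne hΔ hT hy' (hbT0 y' hy')
        (by linarith [hL1 y' hy']) (by linarith) (hfoc y' hy') hne)
    have hy : y' = bJ Δ T_AJ η x' := by
      by_contra hne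
      exact (hUJ (bJ Δ T_AJ η x') (le_max_right _ _)).not_gt (UJ_lt_of_ne hT hη hη0
        (by linarith) (by rw [hx]; linarith [hL1 y' hy']) hy' hne)
    have hfix' : F y' = y' := by
      rw [hFeq y' hy', ← hx, ← hy]
    have hyy : y' = ye := hF.fixedPoint_unique hfix'
    exact ⟨by rw [hx, hyy], hyy⟩
  · rw [← Filter.tendsto_add_atTop_iff_nat 1, tendsto_iff_dist_tendsto_zero]
    refine squeeze_zero (fun _ => dist_nonneg) (fun i => ?_)
      (by simpa using (tendsto_iff_dist_tendsto_zero.1 hysT).const_mul 2)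
    rw [hxsS]
    exact hbTdist _ _ (hys i) hye
end

section
/- Suppose χ(x) < 0 for every x ≥ 2Δ, where χ(x) := √(log(x/Δ)/η) − T_AJ − x/2 and η := c_T·P·log 2 (so the jammer's best response b_J vanishes identically on [2Δ, ∞)). Then the Stackelberg leader objective x ↦ U_T(x, b_J(x)) = C(x, 0) attains its unique maximum over [2Δ, ∞) at x₀ := b_T(0), the unique x > e·Δ with x·log(x/(e·Δ)) = 2·T_AJ; hence (x₀, 0) is the unique Stackelberg equilibrium. -/
/-- suppose `χ(x) < 0` for every `x ≥ 2Δ` (with `η = c_T·P·log 2`), so that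
the jammer's best response `b_J` vanishes identically on `[2Δ, ∞)`.  Then the Stackelberg
leader objective `x ↦ U_T(x, b_J(x)) = C(x, 0)` attains its unique maximum over `[2Δ, ∞)`
at `x₀ := b_T(0)`, the unique `x > e·Δ` with `x·log(x/(e·Δ)) = 2·T_AJ`; hence `(x₀, 0)`
is the unique Stackelberg equilibrium. -/
theorem stmt_15 (Δ T_AJ P c_T η : ℝ)
    (hΔ : 0 < Δ) (hT : 0 < T_AJ) (hP : 0 < P) (hc : 0 < c_T)
    (hη : η = c_T * P * Real.log 2)
    (hchi : ∀ x : ℝ, 2 * Δ ≤ x → chi Δ T_AJ η x < 0)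
    (x₀ : ℝ) (hx₀ : Real.exp 1 * Δ < x₀)
    (hx₀eq : x₀ * Real.log (x₀ / (Real.exp 1 * Δ)) = 2 * T_AJ)
    (hx₀uniq : ∀ z : ℝ, Real.exp 1 * Δ < z →
      z * Real.log (z / (Real.exp 1 * Δ)) = 2 * T_AJ → z = x₀) :
    (∀ x : ℝ, 2 * Δ ≤ x → bJ Δ T_AJ η x = 0 ∧
      UT Δ T_AJ x (bJ Δ T_AJ η x) = Cap Δ T_AJ x 0) ∧
    (∀ x : ℝ, 2 * Δ ≤ x → x ≠ x₀ →
      UT Δ T_AJ x (bJ Δ T_AJ η x) < UT Δ T_AJ x₀ (bJ Δ T_AJ η x₀)) ∧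
    bJ Δ T_AJ η x₀ = 0 := by
  have h_e : (2 : ℝ) < Real.exp 1 := by linarith [Real.exp_one_gt_d9]
  have hx₀' : 2 * Δ ≤ x₀ := by nlinarith
  have hx₀pos : 0 < x₀ := by linarith
  have hb : ∀ x : ℝ, 2 * Δ ≤ x → bJ Δ T_AJ η x = 0 := fun x hx =>
    max_eq_right (hchi x hx).le
  refine ⟨fun x hx => ⟨hb x hx, by rw [hb x hx, UT]⟩, fun x hx hne => ?_, hb x₀ hx₀'⟩
  have hxpos : 0 < x := by linarith
  have hlog₀ : x₀ * (Real.log (x₀ / Δ) - 1) = 2 * T_AJ := by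
    rw [← hx₀eq, Real.log_div hx₀pos.ne' hΔ.ne', Real.log_div hx₀pos.ne' (by positivity),
      Real.log_mul (Real.exp_pos 1).ne' hΔ.ne', Real.log_exp]
    ring
  have htangent : Real.log (x / Δ) - Real.log (x₀ / Δ) < x / x₀ - 1 := by
    have h := Real.log_lt_sub_one_of_pos (div_pos hxpos hx₀pos)
      (fun h => hne ((div_eq_one_iff_eq hx₀pos.ne').1 h))
    rw [Real.log_div hxpos.ne' hx₀pos.ne'] at h
    rw [Real.log_div hxpos.ne' hΔ.ne', Real.log_div hx₀pos.ne' hΔ.ne']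
    linarith
  have hkey : x₀ * Real.log (x / Δ) < 2 * T_AJ + x := by
    have h := mul_lt_mul_of_pos_left htangent hx₀pos
    have hcancel : x₀ * (x / x₀ - 1) = x - x₀ := by field_simp
    rw [hcancel] at h
    linarith
  have hlog2 : 0 < Real.log 2 := Real.log_pos one_lt_two
  rw [hb x hx, hb x₀ hx₀', UT, UT, Cap, Cap, Real.logb, Real.logb, div_right_comm,
    div_right_comm (Real.log (x₀ / Δ))]
  refine div_lt_div_of_pos_right ?_ hlog2
  have hmax : Real.log (x₀ / Δ) / (T_AJ + 0 + x₀ / 2) = 2 / x₀ := by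
    rw [div_eq_div_iff (by positivity) hx₀pos.ne']
    linarith
  rw [hmax, div_lt_div_iff₀ (by positivity) hx₀pos]
  linarith
end

section
/- Assume χ(b_T(0)) > 0, where χ(x) := √(log(x/Δ)/η) − T_AJ − x/2, η := c_T·P·log 2, and b_T(0) is the unique x > e·Δ with x·log(x/(e·Δ)) = 2·T_AJ. Then χ has a largest zero x₂ ∈ (b_T(0), ∞) (i.e., χ(x₂) = 0 and χ(x) < 0 for all x > x₂), and x₂ is the unique maximizer of the Stackelberg leader objective x ↦ U_T(x, b_J(x)) over [2Δ, ∞): for every x ∈ [2Δ, ∞) with x ≠ x₂, U_T(x, b_J(x)) < U_T(x₂, b_J(x₂)). Moreover b_J(x₂) = 0, so (x₂, 0) is the unique Stackelberg equilibrium. -/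
/-- Beyond the point where `2 T + x ≤ x log (x / Δ)`, the ratio `log (x / Δ) / (T + x / 2)` is
strictly decreasing (stated in cross-multiplied form). -/
theorem log_div_mul_lt_of_lt {Δ T x y : ℝ} (hΔ : 0 < Δ) (hT : 0 < T) (hx : 0 < x) (hxy : x < y)
    (h : 2 * T + x ≤ x * Real.log (x / Δ)) :
    Real.log (y / Δ) * (T + x / 2) < Real.log (x / Δ) * (T + y / 2) := by
  have hy : 0 < y := hx.trans hxy
  have hlog : Real.log (y / x) < y / x - 1 :=
    Real.log_lt_sub_one_of_pos (by positivity)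
      (by rw [ne_eq, div_eq_one_iff_eq hx.ne']; exact hxy.ne')
  have hsplit : Real.log (y / Δ) = Real.log (x / Δ) + Real.log (y / x) := by
    rw [Real.log_div hy.ne' hΔ.ne', Real.log_div hx.ne' hΔ.ne', Real.log_div hy.ne' hx.ne']
    ring
  have hstep : Real.log (y / x) * (T + x / 2) < (y / x - 1) * (T + x / 2) := by gcongr
  have hslope : (y / x - 1) * (T + x / 2) ≤ Real.log (x / Δ) * ((y - x) / 2) := by
    have hnn : 0 ≤ (y - x) / (2 * x) := div_nonneg (by linarith) (by positivity)
    calc (y / x - 1) * (T + x / 2) = (y - x) / (2 * x) * (2 * T + x) := by field_simp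
      _ ≤ (y - x) / (2 * x) * (x * Real.log (x / Δ)) := by gcongr
      _ = Real.log (x / Δ) * ((y - x) / 2) := by field_simp
  rw [hsplit]
  linarith

theorem exists_zero_chi {Δ T η xm : ℝ} (hΔ : 0 < Δ) (hT : 0 < T) (hη : 0 < η) (hxm : 0 < xm)
    (hchi : 0 < chi Δ T η xm) : ∃ x, xm < x ∧ chi Δ T η x = 0 := by
  set M := xm + 4 / (Δ * η)
  have hpos : 0 < 4 / (Δ * η) := by positivity
  have hMpos : 0 < M := by positivity
  have hsqrt : Real.sqrt (Real.log (M / Δ) / η) ≤ M / 2 := by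
    refine Real.sqrt_le_iff.2 ⟨by positivity, ?_⟩
    have hlog : Real.log (M / Δ) ≤ M / Δ := Real.log_le_self (by positivity)
    calc Real.log (M / Δ) / η ≤ M / Δ / η := by gcongr
      _ = M / 4 * (4 / (Δ * η)) := by field_simp
      _ ≤ M / 4 * M := by gcongr; linarith
      _ = (M / 2) ^ 2 := by ring
  have hneg : chi Δ T η M < 0 := by unfold chi; linarith
  have hcont : ContinuousOn (chi Δ T η) (Set.Icc xm M) := by
    unfold chi
    have hlog : ContinuousOn (fun x : ℝ => Real.log (x / Δ)) (Set.Icc xm M) :=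
      (continuousOn_id.div_const Δ).log fun x hx =>
        (div_pos (hxm.trans_le hx.1) hΔ).ne'
    exact (((hlog.div_const η).sqrt).sub continuousOn_const).sub (continuousOn_id.div_const 2)
  obtain ⟨x, hx, hx0⟩ := intermediate_value_Icc' (by linarith) hcont ⟨hneg.le, hchi.le⟩
  refine ⟨x, lt_of_le_of_ne hx.1 ?_, hx0⟩
  rintro rfl
  exact hchi.ne' hx0

theorem two_mul_add_le_mul_log {Δ T x y : ℝ} (hΔ : 0 < Δ) (hx : Real.exp 1 * Δ < x)
    (hxeq : x * Real.log (x / (Real.exp 1 * Δ)) = 2 * T) (hxy : x ≤ y) :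
    2 * T + y ≤ y * Real.log (y / Δ) := by
  have hx0 : 0 < x := lt_trans (by positivity) hx
  have hlog : Real.log (y / Δ) = Real.log (y / (Real.exp 1 * Δ)) + 1 := by
    rw [Real.log_div (hx0.trans_le hxy).ne' hΔ.ne', Real.log_div (hx0.trans_le hxy).ne' (by positivity),
      Real.log_mul (Real.exp_ne_zero 1) hΔ.ne', Real.log_exp]
    ring
  have hnn : 0 ≤ Real.log (x / (Real.exp 1 * Δ)) :=
    Real.log_nonneg ((one_le_div (by positivity)).2 hx.le)
  have hmono : x * Real.log (x / (Real.exp 1 * Δ)) ≤ y * Real.log (y / (Real.exp 1 * Δ)) := by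
    gcongr
    exact hx0.le.trans hxy
  rw [hlog]
  linarith

/-- Against the jammer's best response, the leader's utility is at most
`√(η log (x / Δ)) / log 2`. -/
theorem UT_bJ_le {Δ T η x : ℝ} (hη : 0 < η) (hlog : 0 < Real.log (x / Δ)) :
    UT Δ T x (bJ Δ T η x) ≤ η * Real.sqrt (Real.log (x / Δ) / η) / Real.log 2 := by
  have hlog2 : 0 < Real.log 2 := Real.log_pos one_lt_two
  set r := Real.sqrt (Real.log (x / Δ) / η) with hr
  have hrpos : 0 < r := Real.sqrt_pos.2 (by positivity)
  have hL : Real.log (x / Δ) = η * r ^ 2 := by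
    rw [hr, Real.sq_sqrt (by positivity)]
    field_simp
  have hden : r ≤ T + bJ Δ T η x + x / 2 := by
    have : chi Δ T η x ≤ bJ Δ T η x := le_max_left _ _
    unfold chi at this
    linarith
  unfold UT Cap Real.logb
  calc Real.log (x / Δ) / Real.log 2 / (T + bJ Δ T η x + x / 2)
      ≤ Real.log (x / Δ) / Real.log 2 / r := by gcongr
    _ = η * r / Real.log 2 := by rw [hL]; field_simp

/-- assume `χ(b_T(0)) > 0`, where `b_T(0)` is the unique `x > e·Δ` with
`x·log(x/(e·Δ)) = 2·T_AJ` and `η = c_T·P·log 2`.  Then `χ` has a largest zero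
`x₂ ∈ (b_T(0), ∞)` (i.e. `χ(x₂) = 0` and `χ(x) < 0` for all `x > x₂`), and `x₂` is the
unique maximizer of the Stackelberg leader objective `x ↦ U_T(x, b_J(x))` over `[2Δ, ∞)`.
Moreover `b_J(x₂) = 0`, so `(x₂, 0)` is the unique Stackelberg equilibrium. -/
theorem stmt_16 (Δ T_AJ P c_T η : ℝ)
    (hΔ : 0 < Δ) (hT : 0 < T_AJ) (hP : 0 < P) (hc : 0 < c_T)
    (hη : η = c_T * P * Real.log 2)
    (xm : ℝ) (hxm : Real.exp 1 * Δ < xm)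
    (hxmeq : xm * Real.log (xm / (Real.exp 1 * Δ)) = 2 * T_AJ)
    (hxmuniq : ∀ z : ℝ, Real.exp 1 * Δ < z →
      z * Real.log (z / (Real.exp 1 * Δ)) = 2 * T_AJ → z = xm)
    (hchi : 0 < chi Δ T_AJ η xm) :
    ∃ x₂ : ℝ, xm < x₂ ∧ chi Δ T_AJ η x₂ = 0 ∧
      (∀ x : ℝ, x₂ < x → chi Δ T_AJ η x < 0) ∧
      (∀ x : ℝ, 2 * Δ ≤ x → x ≠ x₂ →
        UT Δ T_AJ x (bJ Δ T_AJ η x) < UT Δ T_AJ x₂ (bJ Δ T_AJ η x₂)) ∧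
      bJ Δ T_AJ η x₂ = 0 := by
  have hlog2 : 0 < Real.log 2 := Real.log_pos one_lt_two
  have hη0 : 0 < η := by rw [hη]; positivity
  have hxm0 : 0 < xm := lt_trans (by positivity) hxm
  obtain ⟨x₂, hx₂, hzero⟩ := exists_zero_chi hΔ hT hη0 hxm0 hchi
  have hx₂0 : 0 < x₂ := hxm0.trans hx₂
  have hb₂ : bJ Δ T_AJ η x₂ = 0 := by simp [bJ, hzero]
  have hr₂ : Real.sqrt (Real.log (x₂ / Δ) / η) = T_AJ + x₂ / 2 := by
    unfold chi at hzero
    linarith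
  have hL₂ : Real.log (x₂ / Δ) = η * (T_AJ + x₂ / 2) ^ 2 := by
    have hpos : 0 < Real.log (x₂ / Δ) / η := Real.sqrt_pos.1 (by rw [hr₂]; positivity)
    rw [← hr₂, Real.sq_sqrt hpos.le]
    field_simp
  have hratio : ∀ x, x₂ < x →
      Real.log (x / Δ) * (T_AJ + x₂ / 2) < Real.log (x₂ / Δ) * (T_AJ + x / 2) := fun x hx =>
    log_div_mul_lt_of_lt hΔ hT hx₂0 hx (two_mul_add_le_mul_log hΔ hxm hxmeq hx₂.le)
  have hneg : ∀ x, x₂ < x → chi Δ T_AJ η x < 0 := by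
    intro x hx
    have hx0 : 0 < x := hx₂0.trans hx
    have hlt : Real.log (x / Δ) < η * (T_AJ + x₂ / 2) * (T_AJ + x / 2) := by
      have h := hratio x hx
      rw [hL₂] at h
      refine lt_of_mul_lt_mul_right (a := T_AJ + x₂ / 2) ?_ (by positivity)
      linarith
    have hle : η * (T_AJ + x₂ / 2) * (T_AJ + x / 2) ≤ (T_AJ + x / 2) ^ 2 * η := by
      calc η * (T_AJ + x₂ / 2) * (T_AJ + x / 2) ≤ η * (T_AJ + x / 2) * (T_AJ + x / 2) := by gcongr
        _ = (T_AJ + x / 2) ^ 2 * η := by ring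
    have hsqrt : Real.sqrt (Real.log (x / Δ) / η) < T_AJ + x / 2 := by
      rw [Real.sqrt_lt' (by positivity), div_lt_iff₀ hη0]
      exact hlt.trans_le hle
    unfold chi
    linarith
  refine ⟨x₂, hx₂, hzero, hneg, fun x hx hne => ?_, hb₂⟩
  have hx0 : 0 < x := by linarith
  rcases hne.lt_or_gt with hlt | hgt
  · have hL : 0 < Real.log (x / Δ) := Real.log_pos ((one_lt_div hΔ).2 (by linarith))
    calc UT Δ T_AJ x (bJ Δ T_AJ η x)
        ≤ η * Real.sqrt (Real.log (x / Δ) / η) / Real.log 2 := UT_bJ_le hη0 hL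
      _ < η * Real.sqrt (Real.log (x₂ / Δ) / η) / Real.log 2 := by gcongr
      _ = UT Δ T_AJ x₂ (bJ Δ T_AJ η x₂) := by
        rw [hr₂, hb₂, UT, Cap, Real.logb, hL₂]
        field_simp
        ring
  · have hb : bJ Δ T_AJ η x = 0 := max_eq_right (hneg x hgt).le
    rw [hb, hb₂]
    simp only [UT, Cap, Real.logb, add_zero]
    rw [div_right_comm, div_right_comm (Real.log (x₂ / Δ))]
    refine div_lt_div_of_pos_right ?_ hlog2
    rw [div_lt_div_iff₀ (by positivity) (by positivity)]
    exact hratio x hgt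
end

section
/- Let (x_NE, y_NE) be a Nash equilibrium of the jamming game with y_NE > 0 (interior equilibrium), and let x_SE be the largest zero of χ, i.e., χ(x_SE) = 0 and χ(x) < 0 for x > x_SE. Then x_NE < x_SE and the target node's utility at the Stackelberg equilibrium strictly exceeds its utility at the Nash equilibrium: C(x_SE, 0) > C(x_NE, y_NE). Conversely, if y_NE = 0 then the Stackelberg equilibrium coincides with the Nash equilibrium (b_T(0), 0) and the target node's utilities at the two equilibria are equal. -/
/-- A maximiser of the jammer's utility is the jammer's best response. -/
theorem eq_bJ_of_forall_UJ_le {Δ T_AJ P c_T x y : ℝ} (hT : 0 < T_AJ) (hP : 0 < P) (hc : 0 < c_T)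
    (hx : 0 < x) (hL : 0 ≤ Real.log (x / Δ)) (hy : 0 ≤ y)
    (hmax : ∀ z : ℝ, 0 ≤ z → UJ Δ T_AJ P c_T x z ≤ UJ Δ T_AJ P c_T x y) :
    y = bJ Δ T_AJ (c_T * P * Real.log 2) x := by
  have h2 : 0 < Real.log 2 := Real.log_pos one_lt_two
  have hη : 0 < c_T * P * Real.log 2 := by positivity
  have hr0 : 0 ≤ Real.sqrt (Real.log (x / Δ) / (c_T * P * Real.log 2)) := Real.sqrt_nonneg _
  have hr2 := Real.sq_sqrt (div_nonneg hL hη.le)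
  unfold bJ chi
  set r := Real.sqrt (Real.log (x / Δ) / (c_T * P * Real.log 2))
  have hLr : Real.log (x / Δ) = c_T * P * Real.log 2 * r ^ 2 := by
    rw [hr2]; field_simp
  have key : ∀ z : ℝ, 0 ≤ z →
      r ^ 2 / (T_AJ + y + x / 2) + y ≤ r ^ 2 / (T_AJ + z + x / 2) + z := by
    intro z hz
    have hcap : ∀ w : ℝ, UJ Δ T_AJ P c_T x w
        = -(c_T * P) * (r ^ 2 / (T_AJ + w + x / 2) + w) := by
      intro w
      unfold UJ Cap Real.logb
      rw [hLr]
      field_simp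
      ring
    have h := hmax z hz
    rw [hcap, hcap] at h
    have hcP : 0 < c_T * P := by positivity
    nlinarith
  have hs : 0 < T_AJ + y + x / 2 := by positivity
  rcases le_total 0 (r - T_AJ - x / 2) with hχ | hχ
  · rw [max_eq_left hχ]
    have h := key _ hχ
    have hr : 0 < r := by linarith
    have e : T_AJ + (r - T_AJ - x / 2) + x / 2 = r := by ring
    rw [e, pow_two, mul_self_div_self, ← pow_two] at h
    have h' : r ^ 2 / (T_AJ + y + x / 2) ≤ 2 * r - (T_AJ + y + x / 2) := by linarith
    rw [div_le_iff₀ hs] at h'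
    have : (r - (T_AJ + y + x / 2)) ^ 2 = 0 := le_antisymm (by nlinarith) (sq_nonneg _)
    have := pow_eq_zero_iff two_ne_zero |>.1 this
    linarith
  · rw [max_eq_right hχ]
    by_contra hne
    have hpos : 0 < y := lt_of_le_of_ne hy (Ne.symm hne)
    have h := key 0 le_rfl
    have hs0 : 0 < T_AJ + 0 + x / 2 := by positivity
    have h' : y ≤ r ^ 2 / (T_AJ + 0 + x / 2) - r ^ 2 / (T_AJ + y + x / 2) := by linarith
    rw [div_sub_div _ _ hs0.ne' hs.ne', le_div_iff₀ (mul_pos hs0 hs)] at h'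
    have hlt : r ^ 2 < (T_AJ + 0 + x / 2) * (T_AJ + y + x / 2) := by nlinarith
    nlinarith [mul_pos hpos (sub_pos.2 hlt)]

/-- A maximiser of the target node's utility satisfies the first order condition. -/
theorem mul_log_eq_of_forall_UT_le {Δ T_AJ x y : ℝ} (hΔ : 0 < Δ) (hT : 0 < T_AJ) (hy : 0 ≤ y)
    (hx : 2 * Δ ≤ x) (hmax : ∀ z : ℝ, 2 * Δ ≤ z → UT Δ T_AJ z y ≤ UT Δ T_AJ x y) :
    x * Real.log (x / Δ) = 2 * (T_AJ + y) + x := by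
  have h2 : 0 < Real.log 2 := Real.log_pos one_lt_two
  have hx0 : 0 < x := by linarith
  have hs : 0 < T_AJ + y + x / 2 := by positivity
  have hd : HasDerivAt (fun z => UT Δ T_AJ z y)
      (((1 / x / Real.log 2) * (T_AJ + y + x / 2) - Real.logb 2 (x / Δ) * (1 / 2))
        / (T_AJ + y + x / 2) ^ 2) x := by
    have h1 : HasDerivAt (fun z => Real.logb 2 (z / Δ)) (1 / x / Real.log 2) x := by
      have := (((hasDerivAt_id x).div_const Δ).log (div_pos hx0 hΔ).ne').div_const (Real.log 2)
      have e : 1 / Δ / (x / Δ) / Real.log 2 = 1 / x / Real.log 2 := by field_simp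
      exact e ▸ this
    have h3 : HasDerivAt (fun z : ℝ => T_AJ + y + z / 2) (1 / 2) x :=
      ((hasDerivAt_id x).div_const 2).const_add _
    exact h1.div h3 hs.ne'
  have hlt : 2 * Δ < x := by
    refine lt_of_le_of_ne hx fun heq => ?_
    subst heq
    have hpos : 0 < ((1 / (2 * Δ) / Real.log 2) * (T_AJ + y + 2 * Δ / 2)
        - Real.logb 2 (2 * Δ / Δ) * (1 / 2)) / (T_AJ + y + 2 * Δ / 2) ^ 2 := by
      apply div_pos _ (by positivity)
      have e : 2 * Δ / Δ = 2 := by field_simp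
      rw [e, Real.logb_self_eq_one one_lt_two, sub_pos, div_div, div_mul_eq_mul_div,
        lt_div_iff₀ (by positivity)]
      have : Real.log 2 < 1 := by linarith [Real.log_two_lt_d9]
      nlinarith
    have hle := hasDerivWithinAt_iff_tendsto_slope.1 (hd.hasDerivWithinAt (s := Set.Ioi (2 * Δ)))
    rw [Set.sdiff_singleton_eq_self Set.self_notMem_Ioi] at hle
    have hnp := le_of_tendsto hle (b := 0) (by
      filter_upwards [self_mem_nhdsWithin] with z hz
      rw [slope_def_field]
      have hz' : 2 * Δ < z := hz
      exact div_nonpos_of_nonpos_of_nonneg (sub_nonpos.2 (hmax z hz'.le)) (by linarith))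
    linarith
  have hloc : IsLocalMax (fun z => UT Δ T_AJ z y) x := by
    filter_upwards [lt_mem_nhds hlt] with z hz using hmax z hz.le
  have h0 := hloc.hasDerivAt_eq_zero hd
  rw [div_eq_zero_iff, or_iff_left (by positivity)] at h0
  unfold Real.logb at h0
  field_simp at h0
  linarith

/-- let `(x_NE, y_NE)` be a Nash equilibrium of the jamming game and let
`x₀ := b_T(0)` be the unique `x > e·Δ` with `x·log(x/(e·Δ)) = 2·T_AJ`.  If `y_NE > 0`
(interior equilibrium) and `x_SE` is the largest zero of `χ` (i.e. `χ(x_SE) = 0` and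
`χ(x) < 0` for `x > x_SE`), then `x_NE < x_SE` and `C(x_SE, 0) > C(x_NE, y_NE)`.
Conversely, if `y_NE = 0` then the Stackelberg equilibrium coincides with the Nash
equilibrium `(b_T(0), 0)` and the target node's utilities at the two equilibria are
equal. -/
theorem stmt_17 (Δ T_AJ P c_T η : ℝ)
    (hΔ : 0 < Δ) (hT : 0 < T_AJ) (hP : 0 < P) (hc : 0 < c_T)
    (hη : η = c_T * P * Real.log 2)
    (xNE yNE : ℝ) (hNE : IsNE Δ T_AJ P c_T xNE yNE)
    (x₀ : ℝ) (hx₀ : Real.exp 1 * Δ < x₀)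
    (hx₀eq : x₀ * Real.log (x₀ / (Real.exp 1 * Δ)) = 2 * T_AJ)
    (hx₀uniq : ∀ z : ℝ, Real.exp 1 * Δ < z →
      z * Real.log (z / (Real.exp 1 * Δ)) = 2 * T_AJ → z = x₀) :
    (∀ xSE : ℝ, 0 < yNE → chi Δ T_AJ η xSE = 0 →
      (∀ x : ℝ, xSE < x → chi Δ T_AJ η x < 0) →
      xNE < xSE ∧ Cap Δ T_AJ xNE yNE < Cap Δ T_AJ xSE 0) ∧
    (yNE = 0 →
      xNE = x₀ ∧
      (∀ x : ℝ, 2 * Δ ≤ x →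
        UT Δ T_AJ x (bJ Δ T_AJ η x) ≤ UT Δ T_AJ x₀ (bJ Δ T_AJ η x₀)) ∧
      bJ Δ T_AJ η x₀ = 0 ∧
      UT Δ T_AJ x₀ (bJ Δ T_AJ η x₀) = UT Δ T_AJ xNE yNE) := by
 
  subst hη
  obtain ⟨hx, hy, hmaxT, hmaxJ⟩ := hNE
  have h2 : 0 < Real.log 2 := Real.log_pos one_lt_two
  have hxpos : 0 < xNE := by linarith
  have hη : 0 < c_T * P * Real.log 2 := by positivity
  have hlog : ∀ x : ℝ, 2 * Δ ≤ x → 0 < Real.log (x / Δ) := fun x hx =>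
    Real.log_pos (by rw [lt_div_iff₀ hΔ]; linarith)
  have hbr := eq_bJ_of_forall_UJ_le hT hP hc hxpos (hlog _ hx).le hy hmaxJ
  refine ⟨fun xSE hpos hzero hneg => ?_, fun hy0 => ?_⟩
  · have hχ : chi Δ T_AJ (c_T * P * Real.log 2) xNE = yNE := by
      unfold bJ at hbr
      rcases max_choice (chi Δ T_AJ (c_T * P * Real.log 2) xNE) 0 with h | h <;> linarith
    have hlt : xNE < xSE := by
      by_contra! hle
      rcases hle.lt_or_eq with h | h
      · linarith [hneg _ h]
      · subst h
        linarith
    refine ⟨hlt, ?_⟩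
    have hcap : ∀ x y : ℝ, 2 * Δ ≤ x → chi Δ T_AJ (c_T * P * Real.log 2) x = y →
        Cap Δ T_AJ x y = c_T * P * Real.sqrt (Real.log (x / Δ) / (c_T * P * Real.log 2)) := by
      intro x y hx hxy
      have hr : 0 < Real.sqrt (Real.log (x / Δ) / (c_T * P * Real.log 2)) :=
        Real.sqrt_pos.2 (div_pos (hlog _ hx) hη)
      have hr2 := Real.sq_sqrt (div_nonneg (hlog _ hx).le hη.le)
      unfold chi at hxy
      unfold Cap Real.logb
      set r := Real.sqrt (Real.log (x / Δ) / (c_T * P * Real.log 2))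
      have e : T_AJ + y + x / 2 = r := by linarith
      rw [eq_div_iff hη.ne'] at hr2
      rw [e, ← hr2]
      field_simp
    rw [hcap _ _ hx hχ, hcap _ _ (by linarith) hzero]
    have := hlog _ hx
    have : 0 < c_T * P := by positivity
    gcongr
  · subst hy0
    have hfoc := mul_log_eq_of_forall_UT_le hΔ hT le_rfl hx hmaxT
    have hsplit : Real.log (xNE / (Real.exp 1 * Δ)) = Real.log (xNE / Δ) - 1 := by
      rw [mul_comm, ← div_div, Real.log_div (by positivity) (Real.exp_pos 1).ne', Real.log_exp]
    have hgt : Real.exp 1 * Δ < xNE := by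
      have h1 : 1 < Real.log (xNE / Δ) := by nlinarith
      rwa [Real.lt_log_iff_exp_lt (by positivity), lt_div_iff₀ hΔ] at h1
    have heq : xNE = x₀ := hx₀uniq _ hgt (by rw [hsplit]; linarith)
    subst heq
    refine ⟨rfl, fun x hx' => ?_, hbr.symm, by rw [← hbr]⟩
    rw [← hbr]
    refine le_trans ?_ (hmaxT x hx')
    have hb : 0 ≤ bJ Δ T_AJ (c_T * P * Real.log 2) x := le_max_right _ _
    have hxp : 0 < x := by linarith
    have : 0 ≤ Real.logb 2 (x / Δ) := (div_pos (hlog x hx') h2).le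
    unfold UT Cap
    gcongr
end

section
/- For every x > Δ with χ(x) ≥ 0, the capacity evaluated at the jammer's best response satisfies the identity C(x, χ(x)) = √(c_T·P·log₂(x/Δ)); consequently, on the region where χ ≥ 0, the Stackelberg leader objective U_T(x, b_J(x)) equals √(c_T·P·log₂(x/Δ)) and is strictly increasing in x. Moreover, for all x, x′ ≥ 2Δ one has |√(c_T·P·log₂(x/Δ)) − √(c_T·P·log₂(x′/Δ))| ≤ (√(c_T·P)/(4·Δ·log 2))·|x − x′|, i.e., x ↦ √(c_T·P·log₂(x/Δ)) is Lipschitz on [2Δ, ∞) with constant √(c_T·P)/(4·Δ·log 2). -/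
/-- On `[2Δ, ∞)` the map `x ↦ √(K · log₂(x/Δ))` grows at rate at most `√K / (4 Δ log 2)`. -/
lemma sqrt_mul_logb_sub_le {Δ K x y : ℝ} (hΔ : 0 < Δ) (hK : 0 ≤ K)
    (hx : 2 * Δ ≤ x) (hxy : x ≤ y) :
    √(K * Real.logb 2 (y / Δ)) - √(K * Real.logb 2 (x / Δ)) ≤
      √K / (4 * Δ * Real.log 2) * (y - x) := by
  have hx0 : 0 < x := by linarith
  have hy0 : 0 < y := by linarith
  have hlog2 : 0 < Real.log 2 := Real.log_pos one_lt_two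
  have one_le_logb {z : ℝ} (hz : 2 * Δ ≤ z) : 1 ≤ Real.logb 2 (z / Δ) := by
    have hz2 : 2 ≤ z / Δ := (le_div_iff₀ hΔ).2 hz
    rw [Real.le_logb_iff_rpow_le one_lt_two (by linarith)]
    simpa using hz2
  have hdiff : Real.logb 2 (y / Δ) - Real.logb 2 (x / Δ) ≤ (y - x) / (2 * Δ * Real.log 2) := by
    have hsub : Real.logb 2 (y / Δ) - Real.logb 2 (x / Δ) = Real.log (y / x) / Real.log 2 := by
      simp only [Real.logb]
      rw [Real.log_div hy0.ne' hΔ.ne', Real.log_div hx0.ne' hΔ.ne',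
        Real.log_div hy0.ne' hx0.ne']
      ring
    have hlog : Real.log (y / x) ≤ (y - x) / (2 * Δ) :=
      calc Real.log (y / x) ≤ y / x - 1 := Real.log_le_sub_one_of_pos (by positivity)
        _ = (y - x) / x := by field_simp
        _ ≤ (y - x) / (2 * Δ) := by
          have : 0 ≤ y - x := by linarith
          gcongr
    rw [hsub, ← div_div]
    gcongr
  have hLx := one_le_logb hx
  have hLy := one_le_logb (hx.trans hxy)
  have hsqrt : √(Real.logb 2 (y / Δ)) - √(Real.logb 2 (x / Δ)) ≤
      (y - x) / (4 * Δ * Real.log 2) := by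
    have hsx := Real.one_le_sqrt.2 hLx
    have hsy := Real.one_le_sqrt.2 hLy
    have hmono : √(Real.logb 2 (x / Δ)) ≤ √(Real.logb 2 (y / Δ)) := by gcongr; norm_num
    have hqx := Real.sq_sqrt (zero_le_one.trans hLx)
    have hqy := Real.sq_sqrt (zero_le_one.trans hLy)
    have hhalf : (y - x) / (4 * Δ * Real.log 2) = (y - x) / (2 * Δ * Real.log 2) / 2 := by
      field_simp
      norm_num
    rw [hhalf]
    nlinarith
  rw [Real.sqrt_mul hK, Real.sqrt_mul hK, ← mul_sub]
  calc _ ≤ √K * ((y - x) / (4 * Δ * Real.log 2)) := by gcongr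
    _ = _ := by ring

/-- The capacity at `y = χ(x)`. -/
lemma Cap_chi {Δ T_AJ K x : ℝ} (hΔ : 0 < Δ) (hK : 0 < K) (hx : Δ < x) :
    Cap Δ T_AJ x (chi Δ T_AJ (K * Real.log 2) x) = √(K * Real.logb 2 (x / Δ)) := by
  have hlog2 : 0 < Real.log 2 := Real.log_pos one_lt_two
  have hL : 0 < Real.logb 2 (x / Δ) := Real.logb_pos one_lt_two ((one_lt_div hΔ).2 hx)
  have hquot : Real.log (x / Δ) / (K * Real.log 2) = Real.logb 2 (x / Δ) / K := by
    rw [Real.logb, div_div, mul_comm K]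
  have hden : T_AJ + chi Δ T_AJ (K * Real.log 2) x + x / 2 = √(Real.logb 2 (x / Δ) / K) := by
    rw [chi, hquot]
    ring
  rw [Cap, hden, div_eq_iff (by positivity), ← Real.sqrt_mul (by positivity)]
  rw [show K * Real.logb 2 (x / Δ) * (Real.logb 2 (x / Δ) / K) = Real.logb 2 (x / Δ) ^ 2 by
    field_simp]
  exact (Real.sqrt_sq hL.le).symm

/-- for every `x > Δ` with `χ(x) ≥ 0` (where `η = c_T·P·log 2`), the capacity
at the jammer's best response satisfies `C(x, χ(x)) = √(c_T·P·log₂(x/Δ))`; consequently, on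
the region where `χ ≥ 0`, the Stackelberg leader objective `U_T(x, b_J(x))` equals
`√(c_T·P·log₂(x/Δ))` and is strictly increasing in `x`.  Moreover
`x ↦ √(c_T·P·log₂(x/Δ))` is Lipschitz on `[2Δ, ∞)` with constant `√(c_T·P)/(4·Δ·log 2)`. -/
theorem stmt_18 (Δ T_AJ P c_T η : ℝ)
    (hΔ : 0 < Δ) (hT : 0 < T_AJ) (hP : 0 < P) (hc : 0 < c_T)
    (hη : η = c_T * P * Real.log 2) :
    (∀ x : ℝ, Δ < x → 0 ≤ chi Δ T_AJ η x →
      Cap Δ T_AJ x (chi Δ T_AJ η x) = Real.sqrt (c_T * P * Real.logb 2 (x / Δ)) ∧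
      UT Δ T_AJ x (bJ Δ T_AJ η x) = Real.sqrt (c_T * P * Real.logb 2 (x / Δ))) ∧
    (∀ x x' : ℝ, Δ < x → 0 ≤ chi Δ T_AJ η x → Δ < x' → 0 ≤ chi Δ T_AJ η x' → x < x' →
      UT Δ T_AJ x (bJ Δ T_AJ η x) < UT Δ T_AJ x' (bJ Δ T_AJ η x')) ∧
    (∀ x x' : ℝ, 2 * Δ ≤ x → 2 * Δ ≤ x' →
      |Real.sqrt (c_T * P * Real.logb 2 (x / Δ)) -
        Real.sqrt (c_T * P * Real.logb 2 (x' / Δ))| ≤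
      Real.sqrt (c_T * P) / (4 * Δ * Real.log 2) * |x - x'|) := by
  have hK : 0 < c_T * P := mul_pos hc hP
  subst hη
  have hUT {x : ℝ} (hx : Δ < x) (hχ : 0 ≤ chi Δ T_AJ (c_T * P * Real.log 2) x) :
      UT Δ T_AJ x (bJ Δ T_AJ (c_T * P * Real.log 2) x) =
        √(c_T * P * Real.logb 2 (x / Δ)) := by
    rw [UT, bJ, max_eq_left hχ, Cap_chi hΔ hK hx]
  refine ⟨fun x hx hχ => ⟨Cap_chi hΔ hK hx, hUT hx hχ⟩, ?_, ?_⟩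
  · intro x x' hx hχ hx' hχ' hlt
    rw [hUT hx hχ, hUT hx' hχ']
    have hL : 0 < Real.logb 2 (x / Δ) := Real.logb_pos one_lt_two ((one_lt_div hΔ).2 hx)
    have hlogb : Real.logb 2 (x / Δ) < Real.logb 2 (x' / Δ) :=
      Real.logb_lt_logb one_lt_two (div_pos (hΔ.trans hx) hΔ) (by gcongr)
    exact Real.sqrt_lt_sqrt (by positivity) (by gcongr)
  · intro x x' hx hx'
    wlog hle : x ≤ x' generalizing x x'
    · rw [abs_sub_comm, abs_sub_comm x]
      exact this x' x hx' hx (le_of_not_ge hle)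
    have hx0 : 0 < x := by linarith
    have hmono : √(c_T * P * Real.logb 2 (x / Δ)) ≤ √(c_T * P * Real.logb 2 (x' / Δ)) := by
      gcongr
      norm_num
    rw [abs_sub_comm, abs_sub_comm x, abs_of_nonneg (sub_nonneg.2 hmono),
      abs_of_nonneg (sub_nonneg.2 hle)]
    exact sqrt_mul_logb_sub_le hΔ hK.le hx hle
end
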